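/- arXiv:1708.08545 — 2 statements merged into one kernel-verified Lean document; each statement's English description precedes it below -/
import Mathlib

section
/- Let p > 1, k ∈ ℕ, and 0 ≤ s < t ≤ 1 be such that u ↦ cos((kπ/2)·I_p(u)) is increasing on [s,t]. Then ∫_s^t cos((kπ/2)·I_p(u)) du > (π_p/(kπ))·(1−s^p)^{1/p}·[sin((kπ/2)G(s,t)) − sin((kπ/2)I_p(s))] + (π_p/(kπ))·(1−t^p)^{1/p}·[sin((kπ/2)I_p(t)) − sin((kπ/2)G(s,t))], where G(s,t) = [(1−s^p)^{1/p}I_p(s) − (1−t^p)^{1/p}I_p(t) + (2/π_p)(t−s)] / [(1−s^p)^{1/p} − (1−t^p)^{1/p}]. -/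
open Real

noncomputable def pip (p : ℝ) : ℝ := 2 * π / (p * Real.sin (π / p))

noncomputable def Ip (p y : ℝ) : ℝ :=
  (2 / pip p) * ∫ t in (0:ℝ)..y, (1 - t ^ p) ^ (-1 / p)

noncomputable def Gfun (p s t : ℝ) : ℝ :=
  ((1 - s ^ p) ^ (1 / p) * Ip p s - (1 - t ^ p) ^ (1 / p) * Ip p t +
      (2 / pip p) * (t - s)) /
    ((1 - s ^ p) ^ (1 / p) - (1 - t ^ p) ^ (1 / p))

lemma pip_pos {p : ℝ} (hp : 1 < p) : 0 < pip p := by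
  have hp0 : 0 < p := by linarith
  have : 0 < Real.sin (π / p) :=
    Real.sin_pos_of_pos_of_lt_pi (by positivity) (div_lt_self Real.pi_pos hp)
  unfold pip
  positivity

lemma intervalIntegrable_one_sub_rpow_zero_one {p : ℝ} (hp : 1 < p) :
    IntervalIntegrable (fun t : ℝ => (1 - t ^ p) ^ (-1 / p)) MeasureTheory.volume 0 1 := by
  have hp0 : 0 < p := by linarith
  have hexp : -1 < -1 / p := by
    rw [lt_div_iff₀ hp0]
    linarith
  have hdom : IntervalIntegrable (fun t : ℝ => (1 - t) ^ (-1 / p)) MeasureTheory.volume 0 1 := by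
    have h := (intervalIntegral.intervalIntegrable_rpow' (a := 0) (b := 1) hexp).comp_sub_left 1
    simpa using h.symm
  have hmeas : Measurable fun t : ℝ => (1 - t ^ p) ^ (-1 / p) := by measurability
  refine hdom.mono_fun hmeas.aestronglyMeasurable ?_
  rw [Set.uIoc_of_le zero_le_one]
  refine (MeasureTheory.ae_restrict_iff' measurableSet_Ioc).2 (Filter.Eventually.of_forall ?_)
  intro x hx
  have hxp : x ^ p ≤ x := by
    simpa using Real.rpow_le_rpow_of_exponent_ge hx.1 hx.2 hp.le
  dsimp only
  rw [Real.norm_of_nonneg (Real.rpow_nonneg (by linarith [hx.2]) _),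
    Real.norm_of_nonneg (Real.rpow_nonneg (by linarith [hx.2]) _)]
  rcases hx.2.eq_or_lt with rfl | hx1
  · simp
  · exact Real.rpow_le_rpow_of_nonpos (by linarith) (by linarith)
      (div_nonpos_of_nonpos_of_nonneg (by norm_num) hp0.le)

lemma intervalIntegrable_one_sub_rpow {p a b : ℝ} (hp : 1 < p) (ha : 0 ≤ a) (hab : a ≤ b)
    (hb : b ≤ 1) :
    IntervalIntegrable (fun t : ℝ => (1 - t ^ p) ^ (-1 / p)) MeasureTheory.volume a b := by
  refine (intervalIntegrable_one_sub_rpow_zero_one hp).mono_set ?_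
  rw [Set.uIcc_of_le hab, Set.uIcc_of_le zero_le_one]
  exact Set.Icc_subset_Icc ha hb

lemma Ip_sub_Ip {p a b : ℝ} (hp : 1 < p) (ha : 0 ≤ a) (hab : a ≤ b) (hb : b ≤ 1) :
    Ip p b - Ip p a = (2 / pip p) * ∫ t in a..b, (1 - t ^ p) ^ (-1 / p) := by
  unfold Ip
  rw [← mul_sub, intervalIntegral.integral_interval_sub_left
    (intervalIntegrable_one_sub_rpow hp le_rfl (ha.trans hab) hb)
    (intervalIntegrable_one_sub_rpow hp le_rfl ha (hab.trans hb))]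

lemma continuousOn_Ip {p : ℝ} (hp : 1 < p) : ContinuousOn (Ip p) (Set.Icc 0 1) := by
  have h := intervalIntegral.continuousOn_primitive_interval (a := (0 : ℝ)) (b := 1)
    (f := fun t : ℝ => (1 - t ^ p) ^ (-1 / p)) (μ := MeasureTheory.volume) (by
      rw [Set.uIcc_of_le zero_le_one]
      exact (intervalIntegrable_iff_integrableOn_Icc_of_le zero_le_one).1
        (intervalIntegrable_one_sub_rpow_zero_one hp))
  rw [Set.uIcc_of_le zero_le_one] at h
  exact h.const_mul _

lemma one_sub_rpow_strictAnti {p a b : ℝ} (hp : 1 < p) (ha : 0 ≤ a) (hab : a < b) (hb : b ≤ 1) :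
    (1 - b ^ p) ^ (1 / p) < (1 - a ^ p) ^ (1 / p) := by
  have hp0 : 0 < p := by linarith
  have h1 : a ^ p < b ^ p := Real.rpow_lt_rpow ha hab hp0
  have h2 : b ^ p ≤ 1 := Real.rpow_le_one (ha.trans hab.le) hb hp0.le
  exact Real.rpow_lt_rpow (by linarith) (by linarith) (by positivity)

lemma one_sub_rpow_nonneg {p a : ℝ} (hp : 1 < p) (ha : 0 ≤ a) (hb : a ≤ 1) :
    0 ≤ (1 - a ^ p) ^ (1 / p) :=
  Real.rpow_nonneg (sub_nonneg.2 (Real.rpow_le_one ha hb (by linarith))) _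

lemma one_sub_rpow_neg_eq_inv {p a : ℝ} (hp : 1 < p) (ha : 0 ≤ a) (hb : a ≤ 1) :
    (1 - a ^ p) ^ (-1 / p) = ((1 - a ^ p) ^ (1 / p))⁻¹ := by
  rw [neg_div, Real.rpow_neg (sub_nonneg.2 (Real.rpow_le_one ha hb (by linarith)))]

/-- `Ip p` lies strictly above its tangent line at the left endpoint. -/
lemma lt_mul_Ip_sub_left {p a b : ℝ} (hp : 1 < p) (ha : 0 ≤ a) (hab : a < b) (hb : b ≤ 1) :
    2 / pip p * (b - a) < (1 - a ^ p) ^ (1 / p) * (Ip p b - Ip p a) := by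
  have hI := intervalIntegrable_one_sub_rpow hp ha hab.le hb
  have hpos : 0 < ∫ r in a..b, ((1 - a ^ p) ^ (1 / p) * (1 - r ^ p) ^ (-1 / p) - 1) := by
    refine intervalIntegral.intervalIntegral_pos_of_pos_on
      ((hI.const_mul _).sub intervalIntegrable_const) (fun r hr => ?_) hab
    have hr0 : 0 ≤ r := ha.trans hr.1.le
    have hw : 0 < (1 - r ^ p) ^ (1 / p) :=
      (one_sub_rpow_nonneg hp (hr0.trans hr.2.le) hb).trans_lt
        (one_sub_rpow_strictAnti hp hr0 hr.2 hb)
    rw [one_sub_rpow_neg_eq_inv hp hr0 (hr.2.le.trans hb), ← div_eq_mul_inv, sub_pos,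
      one_lt_div hw]
    exact one_sub_rpow_strictAnti hp ha hr.1 (hr.2.le.trans hb)
  rw [intervalIntegral.integral_sub (hI.const_mul _) intervalIntegrable_const,
    intervalIntegral.integral_const_mul] at hpos
  simp only [intervalIntegral.integral_const, smul_eq_mul, mul_one] at hpos
  rw [Ip_sub_Ip hp ha hab.le hb]
  have hκ : 0 < 2 / pip p := div_pos two_pos (pip_pos hp)
  nlinarith [mul_pos hκ hpos]

/-- `Ip p` lies strictly above its tangent line at the right endpoint. -/
lemma mul_Ip_sub_lt_right {p a b : ℝ} (hp : 1 < p) (ha : 0 ≤ a) (hab : a < b) (hb : b ≤ 1) :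
    (1 - b ^ p) ^ (1 / p) * (Ip p b - Ip p a) < 2 / pip p * (b - a) := by
  have hI := intervalIntegrable_one_sub_rpow hp ha hab.le hb
  have hpos : 0 < ∫ r in a..b, (1 - (1 - b ^ p) ^ (1 / p) * (1 - r ^ p) ^ (-1 / p)) := by
    refine intervalIntegral.intervalIntegral_pos_of_pos_on
      (intervalIntegrable_const.sub (hI.const_mul _)) (fun r hr => ?_) hab
    have hr0 : 0 ≤ r := ha.trans hr.1.le
    have hlt := one_sub_rpow_strictAnti hp hr0 hr.2 hb
    have hw : 0 < (1 - r ^ p) ^ (1 / p) :=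
      (one_sub_rpow_nonneg hp (hr0.trans hr.2.le) hb).trans_lt hlt
    rwa [one_sub_rpow_neg_eq_inv hp hr0 (hr.2.le.trans hb), ← div_eq_mul_inv, sub_pos,
      div_lt_one hw]
  rw [intervalIntegral.integral_sub intervalIntegrable_const (hI.const_mul _),
    intervalIntegral.integral_const_mul] at hpos
  simp only [intervalIntegral.integral_const, smul_eq_mul, mul_one] at hpos
  rw [Ip_sub_Ip hp ha hab.le hb]
  have hκ : 0 < 2 / pip p := div_pos two_pos (pip_pos hp)
  nlinarith [mul_pos hκ hpos]

lemma strictMonoOn_Ip {p : ℝ} (hp : 1 < p) : StrictMonoOn (Ip p) (Set.Icc 0 1) := by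
  intro a ha b hb hab
  have h := lt_mul_Ip_sub_left hp ha.1 hab hb.2
  have hκ : 0 < 2 / pip p * (b - a) :=
    mul_pos (div_pos two_pos (pip_pos hp)) (sub_pos.2 hab)
  exact sub_pos.1 (pos_of_mul_pos_right (hκ.trans h) (one_sub_rpow_nonneg hp ha.1 ha.2))

lemma strictMonoOn_cos_of_monotoneOn {a b : ℝ} (h : MonotoneOn Real.cos (Set.Icc a b)) :
    StrictMonoOn Real.cos (Set.Icc a b) := by
  intro x hx y hy hxy
  refine lt_of_le_of_ne (h hx hy hxy.le) fun heq => ?_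
  have hconst : ∀ z ∈ Set.Icc x y, Real.cos z = Real.cos x := fun z hz =>
    have hz' : z ∈ Set.Icc a b := ⟨hx.1.trans hz.1, hz.2.trans hy.2⟩
    le_antisymm (heq ▸ h hz' hy hz.2) (h hx hz' hz.1)
  obtain ⟨d, hd0, hd1, hd2⟩ : ∃ d : ℝ, 0 < d ∧ d ≤ 1 ∧ d ≤ (y - x) / 2 :=
    ⟨min 1 ((y - x) / 2), lt_min one_pos (by linarith), min_le_left _ _, min_le_right _ _⟩
  have hm := hconst (x + d) ⟨by linarith, by linarith⟩
  have hr := hconst (x + d + d) ⟨by linarith, by linarith⟩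
  have hl : Real.cos (x + d - d) = Real.cos x := by simp
  have hsin : 0 < Real.sin d := Real.sin_pos_of_pos_of_lt_pi hd0 (by linarith [Real.pi_gt_three])
  rw [← hm, Real.cos_add] at hr
  rw [← hm, Real.cos_sub] at hl
  have hs : Real.sin (x + d) = 0 := by
    have : Real.sin (x + d) * Real.sin d = 0 := by linarith
    exact (mul_eq_zero.1 this).resolve_right hsin.ne'
  have hc : Real.cos (x + d) * (1 - Real.cos d) = 0 := by linarith
  rcases mul_eq_zero.1 hc with hc | hc
  · simpa [hs, hc] using Real.sin_sq_add_cos_sq (x + d)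
  · have := Real.sin_sq_add_cos_sq d
    nlinarith

lemma strictMonoOn_cos_of_monotoneOn_comp_Ip {p c s t : ℝ} (hp : 1 < p) (hc : 0 < c)
    (hs : 0 ≤ s) (hst : s < t) (ht : t ≤ 1)
    (h : MonotoneOn (fun u => Real.cos (c * Ip p u)) (Set.Icc s t)) :
    StrictMonoOn Real.cos (Set.Icc (c * Ip p s) (c * Ip p t)) := by
  have hsub : Set.Icc s t ⊆ Set.Icc 0 1 := Set.Icc_subset_Icc hs ht
  have hsurj := intermediate_value_Icc hst.le
    (((continuousOn_Ip hp).mono hsub).const_mul c)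
  refine strictMonoOn_cos_of_monotoneOn fun x hx y hy hxy => ?_
  obtain ⟨u, hu, rfl⟩ := hsurj hx
  obtain ⟨v, hv, rfl⟩ := hsurj hy
  refine h hu hv ?_
  exact ((strictMonoOn_Ip hp).le_iff_le (hsub hu) (hsub hv)).1 (le_of_mul_le_mul_left hxy hc)

lemma integral_cos_mul_add {m : ℝ} (hm : m ≠ 0) (a b d : ℝ) :
    ∫ u in a..b, Real.cos (m * u + d) = (Real.sin (m * b + d) - Real.sin (m * a + d)) / m := by
  rw [intervalIntegral.integral_comp_mul_add _ hm, integral_cos, smul_eq_mul]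
  ring

theorem stmt_13 (p : ℝ) (hp : 1 < p) (k : ℕ) (hk : 1 ≤ k) (s t : ℝ)
    (hs : 0 ≤ s) (hst : s < t) (ht : t ≤ 1)
    (hinc : MonotoneOn (fun u => Real.cos (k * π / 2 * Ip p u)) (Set.Icc s t)) :
    (∫ u in s..t, Real.cos (k * π / 2 * Ip p u)) >
      pip p / (k * π) * (1 - s ^ p) ^ (1 / p) *
          (Real.sin (k * π / 2 * Gfun p s t) - Real.sin (k * π / 2 * Ip p s)) +
        pip p / (k * π) * (1 - t ^ p) ^ (1 / p) *
          (Real.sin (k * π / 2 * Ip p t) - Real.sin (k * π / 2 * Gfun p s t)) := by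
  have hk0 : (0 : ℝ) < k := by exact_mod_cast hk
  have hc : 0 < k * π / 2 := by positivity
  have hκ : 0 < 2 / pip p := div_pos two_pos (pip_pos hp)
  have hcκ : pip p / (k * π) = 1 / (k * π / 2 * (2 / pip p)) := by
    have := pip_pos hp
    field_simp
  have hcos := strictMonoOn_cos_of_monotoneOn_comp_Ip hp hc hs hst ht hinc
  have hBA := one_sub_rpow_strictAnti hp hs hst ht
  have hB := one_sub_rpow_nonneg hp (hs.trans hst.le) ht
  have hleft := fun u (hu : u ∈ Set.Ioc s t) => lt_mul_Ip_sub_left hp hs hu.1 (hu.2.trans ht)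
  have hright := fun u (hu : u ∈ Set.Ico s t) =>
    mul_Ip_sub_lt_right hp (hs.trans hu.1) hu.2 ht
  have hmono : ∀ u ∈ Set.Icc s t, Ip p s ≤ Ip p u ∧ Ip p u ≤ Ip p t := fun u hu =>
    have hu' : u ∈ Set.Icc (0 : ℝ) 1 := ⟨hs.trans hu.1, hu.2.trans ht⟩
    ⟨(strictMonoOn_Ip hp).monotoneOn ⟨hs, hst.le.trans ht⟩ hu' hu.1,
      (strictMonoOn_Ip hp).monotoneOn hu' ⟨hs.trans hst.le, ht⟩ hu.2⟩
  have hcont : ContinuousOn (fun u => Real.cos (k * π / 2 * Ip p u)) (Set.Icc s t) :=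
    Real.continuous_cos.comp_continuousOn
      (((continuousOn_Ip hp).mono (Set.Icc_subset_Icc hs ht)).const_mul _)
  have hG : Gfun p s t * ((1 - s ^ p) ^ (1 / p) - (1 - t ^ p) ^ (1 / p)) =
      (1 - s ^ p) ^ (1 / p) * Ip p s - (1 - t ^ p) ^ (1 / p) * Ip p t +
        (2 / pip p) * (t - s) :=
    div_mul_cancel₀ _ (sub_pos.2 hBA).ne'
  rw [hcκ]
  generalize Gfun p s t = G at *
  generalize (1 - s ^ p) ^ (1 / p) = A at *
  generalize (1 - t ^ p) ^ (1 / p) = B at *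
  generalize 2 / pip p = κ at *
  generalize (k : ℝ) * π / 2 = c at *
  have hA : 0 < A := hB.trans_lt hBA
  have hGs : Ip p s < G := by
    have := hright s ⟨le_rfl, hst⟩
    nlinarith
  have hGt : G < Ip p t := by
    have := hleft t ⟨hst, le_rfl⟩
    nlinarith
  -- The abscissa at which the two tangent lines meet.
  obtain ⟨v, hv⟩ : ∃ v, κ * (v - s) = A * (G - Ip p s) :=
    ⟨s + A * (G - Ip p s) / κ, by field_simp; ring⟩
  have hv' : κ * (t - v) = B * (Ip p t - G) := by linarith
  have hsv : s < v := by
    have : 0 < κ * (v - s) := hv ▸ mul_pos hA (sub_pos.2 hGs)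
    exact sub_pos.1 (pos_of_mul_pos_right this hκ.le)
  have hvt : v ≤ t := by
    have : 0 ≤ κ * (t - v) := hv' ▸ mul_nonneg hB (sub_nonneg.2 hGt.le)
    exact sub_nonneg.1 (nonneg_of_mul_nonneg_right this hκ)
  have hfirst : 1 / (c * κ) * A * (Real.sin (c * G) - Real.sin (c * Ip p s)) <
      ∫ u in s..v, Real.cos (c * Ip p u) := by
    have hm : c * κ / A ≠ 0 := by positivity
    have hint := integral_cos_mul_add hm s v (c * Ip p s - c * κ / A * s)
    have e1 : c * κ / A * v + (c * Ip p s - c * κ / A * s) = c * G := by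
      field_simp
      linear_combination hv
    have e2 : c * κ / A * s + (c * Ip p s - c * κ / A * s) = c * Ip p s := by ring
    rw [e1, e2] at hint
    have e3 : 1 / (c * κ) * A * (Real.sin (c * G) - Real.sin (c * Ip p s)) =
        (Real.sin (c * G) - Real.sin (c * Ip p s)) / (c * κ / A) := by field_simp
    rw [e3, ← hint]
    have key : ∀ u ∈ Set.Ioc s v,
        Real.cos (c * κ / A * u + (c * Ip p s - c * κ / A * s)) < Real.cos (c * Ip p u) := by
      intro u hu
      have hut : u ≤ t := hu.2.trans hvt
      have hI := hmono u ⟨hu.1.le, hut⟩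
      have e : c * κ / A * u + (c * Ip p s - c * κ / A * s) =
          c * (Ip p s + κ * (u - s) / A) := by ring
      have hge : 0 ≤ κ * (u - s) / A :=
        div_nonneg (mul_nonneg hκ.le (sub_nonneg.2 hu.1.le)) hA.le
      have hlt : κ * (u - s) / A < Ip p u - Ip p s := by
        rw [div_lt_iff₀' hA]
        exact hleft u ⟨hu.1, hut⟩
      rw [e]
      refine hcos ⟨?_, ?_⟩ ⟨?_, ?_⟩ ?_
      · exact mul_le_mul_of_nonneg_left (by linarith) hc.le
      · exact mul_le_mul_of_nonneg_left (by linarith) hc.le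
      · exact mul_le_mul_of_nonneg_left hI.1 hc.le
      · exact mul_le_mul_of_nonneg_left hI.2 hc.le
      · exact mul_lt_mul_of_pos_left (by linarith) hc
    exact intervalIntegral.integral_lt_integral_of_continuousOn_of_le_of_exists_lt hsv
      (by fun_prop) (hcont.mono (Set.Icc_subset_Icc le_rfl hvt)) (fun u hu => (key u hu).le)
      ⟨v, ⟨hsv.le, le_rfl⟩, key v ⟨hsv, le_rfl⟩⟩
  have hsecond : 1 / (c * κ) * B * (Real.sin (c * Ip p t) - Real.sin (c * G)) ≤
      ∫ u in v..t, Real.cos (c * Ip p u) := by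
    rcases hB.eq_or_lt with rfl | hB
    · have : t - v = 0 := by
        rw [zero_mul] at hv'
        exact (mul_eq_zero.1 hv').resolve_left hκ.ne'
      rw [← sub_eq_zero.1 this]
      simp
    have hm : c * κ / B ≠ 0 := by positivity
    have hint := integral_cos_mul_add hm v t (c * Ip p t - c * κ / B * t)
    have e1 : c * κ / B * v + (c * Ip p t - c * κ / B * t) = c * G := by
      field_simp
      linear_combination -hv'
    have e2 : c * κ / B * t + (c * Ip p t - c * κ / B * t) = c * Ip p t := by ring
    rw [e1, e2] at hint
    have e3 : 1 / (c * κ) * B * (Real.sin (c * Ip p t) - Real.sin (c * G)) =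
        (Real.sin (c * Ip p t) - Real.sin (c * G)) / (c * κ / B) := by field_simp
    rw [e3, ← hint]
    refine intervalIntegral.integral_mono_on hvt
      (Continuous.intervalIntegrable (by fun_prop) _ _)
      ((hcont.mono (Set.Icc_subset_Icc hsv.le le_rfl)).intervalIntegrable_of_Icc hvt) ?_
    intro u hu
    have hsu : s ≤ u := hsv.le.trans hu.1
    have hI := hmono u ⟨hsu, hu.2⟩
    have e : c * κ / B * u + (c * Ip p t - c * κ / B * t) =
        c * (Ip p t - κ * (t - u) / B) := by ring
    have hle : Ip p t - Ip p u ≤ κ * (t - u) / B := by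
      rw [le_div_iff₀' hB]
      rcases hu.2.eq_or_lt with rfl | hut
      · simp
      · exact (hright u ⟨hsu, hut⟩).le
    have hge : κ * (t - u) / B ≤ Ip p t - G := by
      rw [div_le_iff₀' hB, ← hv']
      exact mul_le_mul_of_nonneg_left (by linarith [hu.1]) hκ.le
    rw [e]
    refine hcos.monotoneOn ⟨?_, ?_⟩ ⟨?_, ?_⟩ ?_
    · exact mul_le_mul_of_nonneg_left (by linarith) hc.le
    · exact mul_le_mul_of_nonneg_left (by linarith) hc.le
    · exact mul_le_mul_of_nonneg_left hI.1 hc.le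
    · exact mul_le_mul_of_nonneg_left hI.2 hc.le
    · exact mul_le_mul_of_nonneg_left (by linarith) hc.le
  have hadd := intervalIntegral.integral_add_adjacent_intervals
    ((hcont.mono (Set.Icc_subset_Icc le_rfl hvt)).intervalIntegrable_of_Icc
      (μ := MeasureTheory.volume) hsv.le)
    ((hcont.mono (Set.Icc_subset_Icc hsv.le le_rfl)).intervalIntegrable_of_Icc hvt)
  rw [← hadd]
  exact add_lt_add_of_lt_of_le hfirst hsecond
end

section
/- Let c₁, c_p, c_{p²} be real with c_{p²} > 0 and c_{p²} + |c_p| < c₁, and suppose |c_p|(c_{p²} + c₁) ≥ 4 c_{p²} c₁. Then min_{|w|=1} |c₁ + c_p w + c_{p²} w²| = c₁ + c_{p²} − |c_p|. -/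
/-- The squared modulus of a real quadratic at a point of the unit circle. -/
lemma sq_norm_quadratic_of_norm_eq_one (a b c : ℝ) {w : ℂ} (hw : ‖w‖ = 1) :
    ‖(a : ℂ) + (b : ℂ) * w + (c : ℂ) * w ^ 2‖ ^ 2 =
      (a - c) ^ 2 + b ^ 2 + 2 * b * (a + c) * w.re + 4 * a * c * w.re ^ 2 := by
  have hy : w.im ^ 2 = 1 - w.re ^ 2 := by
    have h1 : ‖w‖ ^ 2 = w.re * w.re + w.im * w.im := by
      rw [Complex.sq_norm, Complex.normSq_apply]
    rw [hw] at h1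
    linarith
  rw [Complex.sq_norm, Complex.normSq_apply]
  simp only [pow_two w, Complex.add_re, Complex.add_im, Complex.mul_re, Complex.mul_im,
    Complex.ofReal_re, Complex.ofReal_im]
  linear_combination (b ^ 2 + 2 * b * c * w.re + c ^ 2 * (w.im ^ 2 + w.re ^ 2 + 1) - 2 * a * c) * hy

theorem stmt_18 (c1 cp cp2 : ℝ) (h2 : 0 < cp2) (h : cp2 + |cp| < c1)
    (hcond : |cp| * (cp2 + c1) ≥ 4 * cp2 * c1) :
    IsLeast {v : ℝ | ∃ w : ℂ, ‖w‖ = 1 ∧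
        v = ‖(c1 : ℂ) + (cp : ℂ) * w + (cp2 : ℂ) * w ^ 2‖}
      (c1 + cp2 - |cp|) := by
  have hb : 0 ≤ |cp| := abs_nonneg cp
  have hpos : 0 ≤ c1 + cp2 - |cp| := by linarith
  obtain ⟨s, hs, hcp⟩ : ∃ s : ℝ, s ^ 2 = 1 ∧ cp = s * |cp| := by
    rcases abs_cases cp with ⟨h', -⟩ | ⟨h', -⟩
    · exact ⟨1, by norm_num, by linarith⟩
    · exact ⟨-1, by norm_num, by linarith⟩
  generalize |cp| = b at *
  subst hcp
  constructor
  · have hw : ‖((-s : ℝ) : ℂ)‖ = 1 := by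
      rw [Complex.norm_real, Real.norm_eq_abs, abs_neg]
      exact (sq_eq_sq₀ (abs_nonneg s) zero_le_one).1 (by rw [sq_abs, hs, one_pow])
    refine ⟨_, hw, (sq_eq_sq₀ hpos (norm_nonneg _)).1 ?_⟩
    rw [sq_norm_quadratic_of_norm_eq_one _ _ _ hw, Complex.ofReal_re]
    linear_combination (2 * b * (c1 + cp2) - b ^ 2 - 4 * c1 * cp2) * hs
  · rintro _ ⟨w, hw, rfl⟩
    refine (sq_le_sq₀ hpos (norm_nonneg _)).1 ?_
    rw [sq_norm_quadratic_of_norm_eq_one _ _ _ hw]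
    have hu : |s * w.re| ≤ 1 := by
      have h1 := Complex.abs_re_le_norm w
      rw [hw] at h1
      rw [← sq_le_one_iff_abs_le_one, mul_pow, hs, one_mul]
      exact (sq_le_one_iff_abs_le_one _).2 h1
    obtain ⟨hu1, hu2⟩ := abs_le.1 hu
    have hc : 0 < c1 * cp2 := mul_pos (by linarith) h2
    have key : 0 ≤ (1 + s * w.re) *
        (2 * b * (c1 + cp2) - 4 * (c1 * cp2) * (1 - s * w.re)) := by
      refine mul_nonneg (by linarith) ?_
      nlinarith [mul_nonneg hc.le (show 0 ≤ 1 + s * w.re by linarith)]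
    linear_combination key + (4 * c1 * cp2 * w.re ^ 2 - b ^ 2) * hs
end
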